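/- Let X be a type, d a positive natural number, f : X → ℝ^d, C > 0, B a positive natural number, σ > 0, α > 1, and δ ∈ (0, 1). For a multiset S over X of cardinality B define g(S) = (1/B) · ∑_{x ∈ S} clip_C(f(x)), let s = Cσ/B, and let P_S be the probability measure on ℝ^d with density p_{g(S),s} with respect to Lebesgue measure. Then for any two adjacent multisets S, S' of cardinality B and any measurable set A ⊆ ℝ^d, P_S(A) ≤ exp(2α/σ² + log(1/δ)/(α−1)) · P_{S'}(A) + δ. That is, the sanitized per-batch gradient release of Algorithm 2 satisfies (2α/σ² + log(1/δ)/(α−1), δ)-differential privacy. -/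

import Mathlib

open Real MeasureTheory

/-- DP-SGD clipping: `clip C g = g / max 1 (‖g‖/C)` (scalar division). -/
noncomputable def clip {E : Type*} [NormedAddCommGroup E] [NormedSpace ℝ E]
    (C : ℝ) (g : E) : E := (max 1 (‖g‖ / C))⁻¹ • g

/-- Averaged clipped sum over a multiset batch: `g(S) = (1/B) ∑_{x ∈ S} clip_C (f x)`. -/
noncomputable def avgClip {X E : Type*} [NormedAddCommGroup E] [NormedSpace ℝ E]
    (f : X → E) (C : ℝ) (B : ℕ) (S : Multiset X) : E :=
  (B : ℝ)⁻¹ • (S.map (fun x => clip C (f x))).sum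

/-- Isotropic Gaussian density on `ℝ^d` with mean `μ` and scale `s`. -/
noncomputable def gaussPdfD (d : ℕ) (μ : EuclideanSpace ℝ (Fin d)) (s : ℝ)
    (x : EuclideanSpace ℝ (Fin d)) : ℝ :=
  (2 * π * s ^ 2) ^ (-(d : ℝ) / 2) * Real.exp (-‖x - μ‖ ^ 2 / (2 * s ^ 2))

/-- The Gaussian measure `N(μ, s² I_d)` on `ℝ^d`, as a density w.r.t. Lebesgue measure. -/
noncomputable def gaussMeasure (d : ℕ) (μ : EuclideanSpace ℝ (Fin d)) (s : ℝ) :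
    Measure (EuclideanSpace ℝ (Fin d)) :=
  volume.withDensity (fun x => ENNReal.ofReal (gaussPdfD d μ s x))

/-- Clipping bounds the norm by the threshold. -/
lemma norm_clip_le {E : Type*} [NormedAddCommGroup E] [NormedSpace ℝ E] {C : ℝ} (hC : 0 < C)
    (g : E) : ‖clip C g‖ ≤ C := by
  have hpos : 0 < max 1 (‖g‖ / C) := lt_max_of_lt_left one_pos
  rw [clip, norm_smul, norm_inv, Real.norm_of_nonneg hpos.le, inv_mul_le_iff₀ hpos]
  exact (div_le_iff₀ hC).mp (le_max_right _ _)

/-- The sensitivity of the averaged clipped sum to replacing one element. -/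
lemma norm_avgClip_sub_le {X E : Type*} [DecidableEq X] [NormedAddCommGroup E] [NormedSpace ℝ E]
    (f : X → E) {C : ℝ} (hC : 0 < C) (B : ℕ) {S : Multiset X} {x : X} (hx : x ∈ S) (y : X) :
    ‖avgClip f C B S - avgClip f C B (S.erase x + {y})‖ ≤ 2 * C / B := by
  have hsum : avgClip f C B S - avgClip f C B (S.erase x + {y}) =
      (B : ℝ)⁻¹ • (clip C (f x) - clip C (f y)) := by
    nth_rewrite 1 [← Multiset.cons_erase hx]
    simp only [avgClip, Multiset.map_cons, Multiset.sum_cons, Multiset.map_add,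
      Multiset.map_singleton, Multiset.sum_add, Multiset.sum_singleton, ← smul_sub]
    congr 1
    abel
  have hnorm : ‖clip C (f x) - clip C (f y)‖ ≤ 2 * C := by
    linarith [norm_sub_le (clip C (f x)) (clip C (f y)), norm_clip_le hC (f x),
      norm_clip_le hC (f y)]
  rw [hsum, norm_smul, norm_inv, Real.norm_natCast, inv_mul_eq_div]
  gcongr

lemma measurable_gaussPdfD (d : ℕ) (μ : EuclideanSpace ℝ (Fin d)) (s : ℝ) :
    Measurable (gaussPdfD d μ s) := by
  unfold gaussPdfD
  fun_prop

lemma gaussPdfD_nonneg (d : ℕ) (μ : EuclideanSpace ℝ (Fin d)) (s : ℝ)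
    (x : EuclideanSpace ℝ (Fin d)) : 0 ≤ gaussPdfD d μ s x := by
  unfold gaussPdfD
  positivity

lemma integral_gaussPdfD (d : ℕ) (μ : EuclideanSpace ℝ (Fin d)) {s : ℝ} (hs : 0 < s) :
    ∫ x, gaussPdfD d μ s x = 1 := by
  have hb : 0 < (2 * s ^ 2)⁻¹ := by positivity
  have hint := GaussianFourier.integral_rexp_neg_mul_sq_norm (V := EuclideanSpace ℝ (Fin d)) hb
  simp only [gaussPdfD, integral_const_mul]
  rw [integral_sub_right_eq_self
    (fun x : EuclideanSpace ℝ (Fin d) => Real.exp (-‖x‖ ^ 2 / (2 * s ^ 2))) μ]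
  simp only [neg_div, div_eq_inv_mul _ (2 * s ^ 2), mul_neg, neg_mul] at hint ⊢
  rw [hint, finrank_euclideanSpace_fin, div_inv_eq_mul, ← mul_assoc, mul_comm π 2,
    ← Real.rpow_add (by positivity)]
  convert Real.rpow_zero _ using 2
  ring

lemma gaussMeasure_univ (d : ℕ) (μ : EuclideanSpace ℝ (Fin d)) {s : ℝ} (hs : 0 < s) :
    gaussMeasure d μ s Set.univ = 1 := by
  have hint : Integrable (gaussPdfD d μ s) :=
    Integrable.of_integral_ne_zero (by simp [integral_gaussPdfD d μ hs])
  rw [gaussMeasure, withDensity_apply _ MeasurableSet.univ, Measure.restrict_univ,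
    ← ofReal_integral_eq_lintegral_ofReal hint (.of_forall (gaussPdfD_nonneg d μ s)),
    integral_gaussPdfD d μ hs, ENNReal.ofReal_one]

/-- Expansion of the squared norm of an affine combination. -/
lemma norm_sub_affine_sq {E : Type*} [NormedAddCommGroup E] [InnerProductSpace ℝ E]
    (t : ℝ) (x a b : E) :
    ‖x - (t • a + (1 - t) • b)‖ ^ 2 =
      t * ‖x - a‖ ^ 2 + (1 - t) * ‖x - b‖ ^ 2 - t * (1 - t) * ‖a - b‖ ^ 2 := by
  have hxc : x - (t • a + (1 - t) • b) = t • (x - a) + (1 - t) • (x - b) := by module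
  have hab : a - b = (x - b) - (x - a) := by abel
  rw [hxc, hab]
  generalize x - a = y, x - b = z
  rw [norm_add_sq_real, norm_sub_sq_real, norm_smul, norm_smul, inner_smul_left,
    inner_smul_right, mul_pow, mul_pow, Real.norm_eq_abs, Real.norm_eq_abs, sq_abs, sq_abs,
    real_inner_comm z y]
  simp only [conj_trivial]
  ring

/-- The Gaussian density is dominated by a multiple of a shifted density, up to `δ` times the
density centred at the extrapolated mean `α • a + (1 - α) • b`. -/
lemma gaussPdfD_le (d : ℕ) (a b : EuclideanSpace ℝ (Fin d)) {s K α δ : ℝ} (hs : 0 < s)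
    (hα : 1 < α) (hδ : 0 < δ) (hab : ‖a - b‖ ^ 2 / (2 * s ^ 2) ≤ K)
    (x : EuclideanSpace ℝ (Fin d)) :
    gaussPdfD d a s x ≤
      Real.exp (α * K + Real.log (1 / δ) / (α - 1)) * gaussPdfD d b s x +
        δ * gaussPdfD d (α • a + (1 - α) • b) s x := by
  have hα' : 0 < α - 1 := by linarith
  have hexp : Real.exp (-‖x - a‖ ^ 2 / (2 * s ^ 2)) ≤
      Real.exp (α * K + Real.log (1 / δ) / (α - 1)) * Real.exp (-‖x - b‖ ^ 2 / (2 * s ^ 2)) +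
        δ * Real.exp (-‖x - (α • a + (1 - α) • b)‖ ^ 2 / (2 * s ^ 2)) := by
    have hmean : -‖x - (α • a + (1 - α) • b)‖ ^ 2 / (2 * s ^ 2) =
        α * (-‖x - a‖ ^ 2 / (2 * s ^ 2)) + (1 - α) * (-‖x - b‖ ^ 2 / (2 * s ^ 2)) -
          α * (α - 1) * (‖a - b‖ ^ 2 / (2 * s ^ 2)) := by
      rw [norm_sub_affine_sq]
      ring
    rw [hmean]
    generalize -‖x - a‖ ^ 2 / (2 * s ^ 2) = p
    generalize -‖x - b‖ ^ 2 / (2 * s ^ 2) = q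
    generalize ‖a - b‖ ^ 2 / (2 * s ^ 2) = v at hab
    rw [← Real.exp_add]
    rcases le_total p (α * K + Real.log (1 / δ) / (α - 1) + q) with h | h
    · exact (Real.exp_le_exp.mpr h).trans (le_add_of_nonneg_right (by positivity))
    · refine le_trans ?_ (le_add_of_nonneg_left (Real.exp_pos _).le)
      nth_rewrite 1 [← Real.exp_log hδ]
      rw [← Real.exp_add, Real.exp_le_exp]
      have hloss := mul_le_mul_of_nonneg_left h hα'.le
      have hlog : (α - 1) * (Real.log (1 / δ) / (α - 1)) = -Real.log δ := by
        rw [mul_div_cancel₀ _ hα'.ne', one_div, Real.log_inv]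
      have hdiv : α * (α - 1) * v ≤ α * (α - 1) * K := by gcongr
      linarith
  calc gaussPdfD d a s x
      ≤ (2 * π * s ^ 2) ^ (-(d : ℝ) / 2) * _ := mul_le_mul_of_nonneg_left hexp (by positivity)
    _ = _ := by
      simp only [gaussPdfD]
      ring

/-- Approximate differential privacy of the Gaussian mechanism, with a parameter `α` coming from
the Rényi divergence of order `α`. -/
lemma gaussMeasure_le (d : ℕ) (a b : EuclideanSpace ℝ (Fin d)) {s K α δ : ℝ} (hs : 0 < s)
    (hα : 1 < α) (hδ : 0 < δ) (hab : ‖a - b‖ ^ 2 / (2 * s ^ 2) ≤ K)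
    {A : Set (EuclideanSpace ℝ (Fin d))} (hA : MeasurableSet A) :
    gaussMeasure d a s A ≤
      ENNReal.ofReal (Real.exp (α * K + Real.log (1 / δ) / (α - 1))) * gaussMeasure d b s A +
        ENNReal.ofReal δ := by
  set c := α • a + (1 - α) • b
  set k := Real.exp (α * K + Real.log (1 / δ) / (α - 1))
  have hmeas (μ : EuclideanSpace ℝ (Fin d)) :
      Measurable fun x => ENNReal.ofReal (gaussPdfD d μ s x) :=
    (measurable_gaussPdfD d μ s).ennreal_ofReal
  have hpoint (x : EuclideanSpace ℝ (Fin d)) : ENNReal.ofReal (gaussPdfD d a s x) ≤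
      ENNReal.ofReal k * ENNReal.ofReal (gaussPdfD d b s x) +
        ENNReal.ofReal δ * ENNReal.ofReal (gaussPdfD d c s x) := by
    have hb := gaussPdfD_nonneg d b s x
    have hc := gaussPdfD_nonneg d c s x
    rw [← ENNReal.ofReal_mul (Real.exp_pos _).le, ← ENNReal.ofReal_mul hδ.le,
      ← ENNReal.ofReal_add (by positivity) (by positivity)]
    exact ENNReal.ofReal_le_ofReal (gaussPdfD_le d a b hs hα hδ hab x)
  calc gaussMeasure d a s A
      = ∫⁻ x in A, ENNReal.ofReal (gaussPdfD d a s x) := withDensity_apply _ hA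
    _ ≤ ∫⁻ x in A, ENNReal.ofReal k * ENNReal.ofReal (gaussPdfD d b s x) +
          ENNReal.ofReal δ * ENNReal.ofReal (gaussPdfD d c s x) := lintegral_mono hpoint
    _ = ENNReal.ofReal k * gaussMeasure d b s A + ENNReal.ofReal δ * gaussMeasure d c s A := by
      rw [lintegral_add_left ((hmeas b).const_mul _), lintegral_const_mul _ (hmeas b),
        lintegral_const_mul _ (hmeas c), gaussMeasure, gaussMeasure, withDensity_apply _ hA,
        withDensity_apply _ hA]
    _ ≤ ENNReal.ofReal k * gaussMeasure d b s A + ENNReal.ofReal δ := by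
      gcongr
      exact mul_le_of_le_one_right' ((measure_mono A.subset_univ).trans
        (gaussMeasure_univ d c hs).le)

/-- DP guarantee of the sanitized per-batch gradient release (Algorithm 2): for adjacent
batches `S, S'` of cardinality `B`, writing `P_S = N(g(S), (Cσ/B)² I_d)`, for any
measurable set `A`, `P_S(A) ≤ exp(2α/σ² + log(1/δ)/(α−1)) · P_{S'}(A) + δ`. -/
theorem rapid_dp {X : Type*} [DecidableEq X] (d : ℕ) (hd : 0 < d)
    (f : X → EuclideanSpace ℝ (Fin d)) {C : ℝ} (hC : 0 < C) {B : ℕ} (hB : 0 < B)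
    {σ α δ : ℝ} (hσ : 0 < σ) (hα : 1 < α) (hδ : δ ∈ Set.Ioo (0 : ℝ) 1)
    (S S' : Multiset X) (hS : Multiset.card S = B)
    (xm xp : X) (hxm : xm ∈ S) (hS' : S' = S.erase xm + {xp})
    (A : Set (EuclideanSpace ℝ (Fin d))) (hA : MeasurableSet A) :
    gaussMeasure d (avgClip f C B S) (C * σ / B) A ≤
      ENNReal.ofReal (Real.exp (2 * α / σ ^ 2 + Real.log (1 / δ) / (α - 1))) *
        gaussMeasure d (avgClip f C B S') (C * σ / B) A + ENNReal.ofReal δ := by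
  have hs : 0 < C * σ / B := by positivity
  have hsens := norm_avgClip_sub_le f hC B hxm xp
  rw [← hS'] at hsens
  have hdiv : ‖avgClip f C B S - avgClip f C B S'‖ ^ 2 / (2 * (C * σ / B) ^ 2) ≤ 2 / σ ^ 2 :=
    calc _ ≤ (2 * C / B) ^ 2 / (2 * (C * σ / B) ^ 2) := by gcongr
      _ = 2 / σ ^ 2 := by
        field_simp
  convert gaussMeasure_le d _ _ hs hα hδ.1 hdiv hA using 5
  ring
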